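/- Let T and T' be pretriangulated (triangulated) categories admitting countable coproducts, and let F : T → T' be a triangulated (exact) functor that preserves countable coproducts. Let (X_n)_{n∈ℕ} be a sequence of objects of T with morphisms f_n : X_n → X_{n+1}, and let s : ⊕_{n} X_n → ⊕_{n} X_n be the morphism whose composition with the n-th coproduct inclusion ι_n : X_n → ⊕ X_n equals ι_n − ι_{n+1} ∘ f_n. Let C be any cone of s, i.e. an object fitting into a distinguished triangle ⊕ X_n → ⊕ X_n → C → (⊕ X_n)[1] with first map s. If F(f_n) is an isomorphism for every n, then F(C) is isomorphic to F(X_0). -/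

import Mathlib

open CategoryTheory Category Limits Pretriangulated

section Telescope

variable {D : Type*} [Category D] [Preadditive D] {A : ℕ → D} (a : ∀ n, A n ⟶ A (n + 1))
  [∀ n, IsIso (a n)]

/-- The inverse `A n ⟶ A 0` of the composition of the first `n` maps of a sequence of
isomorphisms. -/
noncomputable def telescopeInv : ∀ n, A n ⟶ A 0
  | 0 => 𝟙 _
  | n + 1 => inv (a n) ≫ telescopeInv n

/-- The components of a retraction of `1 - shift` for a sequence of isomorphisms. -/
noncomputable def telescopeRetraction {P : D} (i : ∀ n, A n ⟶ P) : ∀ n, A n ⟶ P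
  | 0 => 0
  | n + 1 => inv (a n) ≫ (telescopeRetraction i n - i n)

lemma telescopeRetraction_comp {P : D} (i : ∀ n, A n ⟶ P) (S : P ⟶ P)
    (hS : ∀ n, i n ≫ S = i n - a n ≫ i (n + 1)) (n : ℕ) :
    telescopeRetraction a i n ≫ S = i n - telescopeInv a n ≫ i 0 := by
  induction n with
  | zero => simp [telescopeRetraction, telescopeInv]
  | succ n ih =>
    simp only [telescopeRetraction, telescopeInv, assoc, Preadditive.sub_comp, ih, hS]
    simp

/-- For a sequence of isomorphisms, `1 - shift` is a split monomorphism complementary to the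
inclusion of the initial term. -/
lemma exists_telescope_splitting {P : D} (i : ∀ n, A n ⟶ P)
    (hP : IsColimit (Cofan.mk P i)) (S : P ⟶ P)
    (hS : ∀ n, i n ≫ S = i n - a n ≫ i (n + 1)) :
    ∃ (q : P ⟶ A 0) (r : P ⟶ P), S ≫ q = 0 ∧ S ≫ r = 𝟙 P ∧ i 0 ≫ q = 𝟙 (A 0) ∧
      r ≫ S = 𝟙 P - q ≫ i 0 := by
  have fac {Z : D} (k : ∀ n, A n ⟶ Z) (n : ℕ) : i n ≫ Cofan.IsColimit.desc hP k = k n :=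
    Cofan.IsColimit.fac hP k n
  refine ⟨Cofan.IsColimit.desc hP (telescopeInv a),
    Cofan.IsColimit.desc hP (telescopeRetraction a i), ?_, ?_, fac _ 0, ?_⟩ <;>
    refine Cofan.IsColimit.hom_ext hP _ _ fun n => ?_ <;>
    simp only [Cofan.inj, Cofan.mk_ι_app]
  · rw [reassoc_of% (hS n)]
    simp [fac, telescopeInv]
  · rw [reassoc_of% (hS n)]
    simp [fac, telescopeRetraction]
  · rw [← assoc, fac, telescopeRetraction_comp a i S hS, Preadditive.comp_sub, ← assoc, fac]
    exact congrArg (· - telescopeInv a n ≫ i 0) (comp_id (i n)).symm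

/-- The homotopy colimit of a sequence of isomorphisms is its initial term. -/
lemma nonempty_iso_of_distTriang_telescope [HasZeroObject D] [HasShift D ℤ]
    [∀ n : ℤ, (shiftFunctor D n).Additive] [Pretriangulated D] {P : D} (i : ∀ n, A n ⟶ P)
    (hP : IsColimit (Cofan.mk P i)) (S : P ⟶ P)
    (hS : ∀ n, i n ≫ S = i n - a n ≫ i (n + 1)) {C : D} (g : P ⟶ C) (h : C ⟶ P⟦(1 : ℤ)⟧)
    (hC : Triangle.mk S g h ∈ distTriang D) :
    Nonempty (C ≅ A 0) := by
  obtain ⟨q, r, hSq, hSr, hq, hrS⟩ := exists_telescope_splitting a i hP S hS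
  have : Mono S := mono_of_mono_fac hSr
  have hg : Epi g := Triangle.epi₂ _ hC (Triangle.mor₃_eq_zero_of_mono₁ _ hC this)
  obtain ⟨d, hd⟩ : ∃ d : C ⟶ A 0, q = g ≫ d := Triangle.yoneda_exact₂ _ hC q hSq
  have hSg : S ≫ g = 0 := comp_distTriang_mor_zero₁₂ _ hC
  have hqi : q ≫ i 0 = 𝟙 P - r ≫ S := by rw [hrS]; abel
  refine ⟨⟨d, i 0 ≫ g, ?_, by rw [assoc, ← hd, hq]⟩⟩
  rw [← cancel_epi g, ← assoc, ← hd, ← assoc, hqi]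
  simp [Preadditive.sub_comp, hSg]

end Telescope

/-- after Neeman 1.6.6/1.7.1. Let `F : T ⥤ T'` be a triangulated
functor between triangulated categories with countable coproducts, preserving
countable coproducts. Given a sequence `X₀ → X₁ → ⋯` in `T`, let
`s = 1 - shift : ⊕ Xₙ ⟶ ⊕ Xₙ` and let `C` be any cone of `s` (a homotopy colimit of
the sequence). If every `F(fₙ)` is an isomorphism, then `F(C) ≅ F(X₀)`. -/
theorem functor_homotopyColimit_iso
    {T T' : Type*} [Category T] [Category T']
    [HasZeroObject T] [HasZeroObject T']
    [Preadditive T] [Preadditive T']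
    [HasShift T ℤ] [HasShift T' ℤ]
    [∀ n : ℤ, (shiftFunctor T n).Additive] [∀ n : ℤ, (shiftFunctor T' n).Additive]
    [Pretriangulated T] [Pretriangulated T']
    [HasCountableCoproducts T] [HasCountableCoproducts T']
    (F : T ⥤ T') [F.CommShift ℤ] [F.IsTriangulated]
    -- `F` preserves countable coproducts
    (hF : ∀ (J : Type) [Countable J], PreservesColimitsOfShape (Discrete J) F)
    -- the sequence
    (X : ℕ → T) (f : ∀ n : ℕ, X n ⟶ X (n + 1))
    -- the morphism `s : ⊕ Xₙ ⟶ ⊕ Xₙ` with `ιₙ ≫ s = ιₙ - fₙ ≫ ι_{n+1}`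
    (s : (∐ X) ⟶ (∐ X))
    (hs : ∀ n : ℕ, Sigma.ι X n ≫ s = Sigma.ι X n - f n ≫ Sigma.ι X (n + 1))
    -- `C` is a cone of `s`
    (C : T) (g : (∐ X) ⟶ C) (h : C ⟶ (∐ X)⟦(1 : ℤ)⟧)
    (hC : Triangle.mk s g h ∈ distTriang T)
    -- every `F(fₙ)` is an isomorphism
    (hf : ∀ n : ℕ, IsIso (F.map (f n))) :
    Nonempty (F.obj C ≅ F.obj (X 0)) := by
  have := hF ℕ
  exact nonempty_iso_of_distTriang_telescope (fun n => F.map (f n))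
    (fun n => F.map (Sigma.ι X n))
    (isColimitCofanMkObjOfIsColimit F _ _ (coproductIsCoproduct X)) (F.map s)
    (fun n => by rw [← F.map_comp, hs, F.map_sub, F.map_comp]) _ _
    (F.map_distinguished _ hC)
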